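/- arXiv:2003.07652 — 4 statements merged into one kernel-verified Lean document; each statement's English description precedes it below -/
import Mathlib

section
/- Let G be a connected finite simple graph and H a finite simple graph with |V(G)| = |V(H)|, |E(G)| = |E(H)|, and |V(G)| ≥ 2. Then h_H(G) = |E(H)| if and only if H is isomorphic to G. -/
open SimpleGraph

/-- The sum `s_H(f,G) = Σ_{{x,y} ∈ E(H)} ρ_G(f(x), f(y))` of a pseudoordering
`f : V(H) → V(G)` of the graph `G` by the graph `H`. -/
noncomputable def sH {α β : Type} [Fintype α] (H : SimpleGraph α)
    (G : SimpleGraph β) (f : α → β) : ℕ :=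
  ∑ e ∈ H.edgeSet.toFinite.toFinset,
    Sym2.lift ⟨fun x y => G.dist (f x) (f y), fun _ _ => SimpleGraph.dist_comm⟩ e

/-- The lower `H`-Hamiltonian number `h_H(G)`: the minimum of `s_H(f,G)` over all
pseudoorderings (bijections) `f : V(H) → V(G)`. -/
noncomputable def lowerHH {α β : Type} [Fintype α] (H : SimpleGraph α)
    (G : SimpleGraph β) : ℕ :=
  sInf {m | ∃ f : α ≃ β, sH H G ⇑f = m}

/-- The upper `H`-Hamiltonian number `h_H⁺(G)`: the maximum of `s_H(f,G)` over all
pseudoorderings (bijections) `f : V(H) → V(G)`. -/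
noncomputable def upperHH {α β : Type} [Fintype α] (H : SimpleGraph α)
    (G : SimpleGraph β) : ℕ :=
  sSup {m | ∃ f : α ≃ β, sH H G ⇑f = m}

/-- The cyclic sum `s(f,G) = Σ_{i=1}^{n} ρ_G(f(i), f(i+1))` (indices cyclic) of an
ordering `f` of `G`. -/
noncomputable def cyclicSum {V : Type} {n : ℕ} (G : SimpleGraph V) (f : Fin n → V) : ℕ :=
  ∑ i : Fin n, G.dist (f i) (f ⟨(i.val + 1) % n, Nat.mod_lt _ i.pos⟩)

/-- The open sum `s̄(f,G) = Σ_{i=1}^{n-1} ρ_G(f(i), f(i+1))` of an ordering `f` of `G`. -/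
noncomputable def openSum {V : Type} {n : ℕ} (G : SimpleGraph V) (f : Fin n → V) : ℕ :=
  ∑ i : Fin n, if h : i.val + 1 < n then G.dist (f i) (f ⟨i.val + 1, h⟩) else 0

/-- The length of the image under `f` of an unordered pair; `sH` sums it over the edges. -/
noncomputable def imageDist {α β : Type} (G : SimpleGraph β) (f : α → β) : Sym2 α → ℕ :=
  Sym2.lift ⟨fun x y => G.dist (f x) (f y), fun _ _ => SimpleGraph.dist_comm⟩

theorem one_le_imageDist {α β : Type} {H : SimpleGraph α} {G : SimpleGraph β}
    (hG : G.Connected) (f : α ≃ β) {e : Sym2 α} (he : e ∈ H.edgeSet) :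
    1 ≤ imageDist G f e := by
  induction e with
  | h x y =>
    exact hG.pos_dist_of_ne (f.injective.ne (SimpleGraph.Adj.ne (H.mem_edgeSet.1 he)))

theorem ncard_edgeSet_eq_sum {α : Type} [Fintype α] (H : SimpleGraph α) :
    H.edgeSet.ncard = ∑ _e ∈ H.edgeSet.toFinite.toFinset, 1 := by
  rw [Set.ncard_eq_toFinset_card _ H.edgeSet.toFinite, Finset.card_eq_sum_ones]

theorem ncard_edgeSet_le_sH {α β : Type} [Fintype α] (H : SimpleGraph α) {G : SimpleGraph β}
    (hG : G.Connected) (f : α ≃ β) : H.edgeSet.ncard ≤ sH H G f := by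
  rw [ncard_edgeSet_eq_sum]
  exact Finset.sum_le_sum fun e he => one_le_imageDist hG f (by simpa using he)

theorem sH_eq_ncard_edgeSet_iff {α β : Type} [Fintype α] (H : SimpleGraph α)
    {G : SimpleGraph β} (hG : G.Connected) (f : α ≃ β) :
    sH H G f = H.edgeSet.ncard ↔ ∀ x y, H.Adj x y → G.Adj (f x) (f y) := by
  have key := Finset.sum_eq_sum_iff_of_le (s := H.edgeSet.toFinite.toFinset)
    (f := fun _ => 1) (g := imageDist G f)
    fun e he => one_le_imageDist hG f (by simpa using he)
  rw [ncard_edgeSet_eq_sum, eq_comm]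
  refine key.trans ⟨fun h x y hxy => ?_, fun h e he => ?_⟩
  · exact SimpleGraph.dist_eq_one_iff_adj.1 (h s(x, y) (by simpa using hxy)).symm
  · induction e with
    | h x y => exact (SimpleGraph.dist_eq_one_iff_adj.2 (h x y (by simpa using he))).symm

/-- A bijective homomorphism between finite graphs with equally many edges reflects adjacency. -/
theorem adj_of_adj_map_of_ncard_edgeSet_eq {α β : Type} [Finite β]
    {H : SimpleGraph α} {G : SimpleGraph β} (hedge : G.edgeSet.ncard = H.edgeSet.ncard)
    (f : α ≃ β) (hf : ∀ x y, H.Adj x y → G.Adj (f x) (f y)) {x y : α}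
    (hxy : G.Adj (f x) (f y)) : H.Adj x y := by
  have hsub : Sym2.map f '' H.edgeSet ⊆ G.edgeSet := by
    rintro _ ⟨e, he, rfl⟩
    induction e with
    | h x y => exact hf x y he
  have heq := Set.eq_of_subset_of_ncard_le hsub (by
    rw [Set.ncard_image_of_injective _ (Sym2.map.injective f.injective), hedge])
    (Set.toFinite _)
  have hmem : Sym2.map f s(x, y) ∈ Sym2.map f '' H.edgeSet := heq ▸ hxy
  exact (Sym2.map.injective f.injective).mem_set_image.1 hmem

theorem stmt2 {α β : Type} [Fintype α] [Fintype β]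
    (H : SimpleGraph α) (G : SimpleGraph β) (hG : G.Connected)
    (hcard : Fintype.card α = Fintype.card β)
    (hedge : G.edgeSet.ncard = H.edgeSet.ncard) (h2 : 2 ≤ Fintype.card β) :
    lowerHH H G = H.edgeSet.ncard ↔ Nonempty (H ≃g G) := by
  have hex : {m | ∃ f : α ≃ β, sH H G f = m}.Nonempty :=
    ⟨_, Fintype.equivOfCardEq hcard, rfl⟩
  constructor
  · intro h
    obtain ⟨f, hf⟩ := Nat.sInf_mem hex
    have hadj := (sH_eq_ncard_edgeSet_iff H hG f).1 (hf.trans h)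
    exact ⟨⟨f, fun {x y} =>
      ⟨adj_of_adj_map_of_ncard_edgeSet_eq hedge f hadj, hadj x y⟩⟩⟩
  · rintro ⟨φ⟩
    refine le_antisymm (Nat.sInf_le ⟨φ.toEquiv, ?_⟩) (le_csInf hex ?_)
    · exact (sH_eq_ncard_edgeSet_iff H hG φ.toEquiv).2 fun _ _ => φ.map_adj_iff.2
    · rintro _ ⟨f, rfl⟩
      exact ncard_edgeSet_le_sH H hG f
end

section
/- Let G and H be connected finite simple graphs with |V(G)| = |V(H)| ≥ 2. Then h_H⁺(G) ≤ h_H⁺(P_{|V(G)|−1}), and equality holds if and only if G is a path (G is isomorphic to P_{|V(G)|−1}). -/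
open SimpleGraph

namespace SimpleGraph

variable {V : Type*}

/-- Every edge of `K` leaving the vertex set `S` goes from `s ∈ S` to `t ∉ S`. -/
def CrossesOnly (K : SimpleGraph V) (S : Set V) (s t : V) : Prop :=
  ∀ x ∈ S, ∀ y ∉ S, K.Adj x y → x = s ∧ y = t

lemma CrossesOnly.compl {K : SimpleGraph V} {S : Set V} {s t : V} (h : K.CrossesOnly S s t) :
    K.CrossesOnly Sᶜ t s := by
  intro x hx y hy hxy
  exact (h y (not_not.mp hy) x hx hxy.symm).symm

lemma Connected.le_add_dist_of_lipschitz {K : SimpleGraph V} (hK : K.Connected) {g : V → ℕ}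
    (hg : ∀ x y, K.Adj x y → g x ≤ g y + 1) (x y : V) : g x ≤ g y + K.dist x y := by
  obtain ⟨p, hp⟩ := hK.exists_walk_length_eq_dist x y
  rw [← hp]
  clear hp
  induction p with
  | nil => simp
  | cons h p ih =>
    have := hg _ _ h
    rw [Walk.length_cons]
    omega

lemma Connected.dist_le_succ {G : SimpleGraph V} (hG : G.Connected) {x y : V} (h : G.Adj x y)
    (z : V) : G.dist x z ≤ G.dist y z + 1 := by
  have h1 := hG.dist_triangle (u := x) (v := y) (w := z)
  have h2 := dist_eq_one_iff_adj.mpr h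
  omega

section Cut

variable {G K : SimpleGraph V} {S : Set V} {s t : V}

open Classical in
private lemma cut_potential_le (hG : G.Connected) (hK : K.Connected)
    (hin : ∀ z w, (z ∈ S ↔ w ∈ S) → K.Adj z w → G.Adj z w) (hc : K.CrossesOnly S s t)
    (x : V) {y : V} (hy : y ∉ S) :
    (if x ∈ S then G.dist x s + 1 + G.dist t y else G.dist x y) ≤ K.dist x y := by
  have := hK.le_add_dist_of_lipschitz
    (g := fun z => if z ∈ S then G.dist z s + 1 + G.dist t y else G.dist z y) ?_ x y
  · simpa [hy] using this
  intro z w hzw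
  by_cases hz : z ∈ S <;> by_cases hw : w ∈ S <;> simp only [hz, hw, if_true, if_false]
  · have := hG.dist_le_succ (hin z w (by simp [hz, hw]) hzw) s
    omega
  · obtain ⟨rfl, rfl⟩ := hc z hz w hw hzw
    simp
    omega
  · obtain ⟨rfl, rfl⟩ := hc w hw z hz hzw.symm
    omega
  · exact hG.dist_le_succ (hin z w (by simp [hz, hw]) hzw) y

lemma CrossesOnly.le_dist (hc : K.CrossesOnly S s t) (hG : G.Connected) (hK : K.Connected)
    (hin : ∀ z w, (z ∈ S ↔ w ∈ S) → K.Adj z w → G.Adj z w)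
    {x y : V} (hx : x ∈ S) (hy : y ∉ S) :
    G.dist x s + 1 + G.dist t y ≤ K.dist x y := by
  simpa [hx] using cut_potential_le hG hK hin hc x hy

lemma CrossesOnly.dist_le_dist (hc : K.CrossesOnly S s t) (hG : G.Connected) (hK : K.Connected)
    (hin : ∀ z w, (z ∈ S ↔ w ∈ S) → K.Adj z w → G.Adj z w)
    {x y : V} (hxy : x ∈ S ↔ y ∈ S) : G.dist x y ≤ K.dist x y := by
  by_cases hy : y ∈ S
  · have := cut_potential_le (S := Sᶜ) hG hK
      (fun z w h => hin z w (by simpa [not_iff_not] using h)) hc.compl x (y := y) (by simpa using hy)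
    simpa [hxy.mpr hy] using this
  · have hx : x ∉ S := fun h => hy (hxy.mp h)
    simpa [hx] using cut_potential_le hG hK hin hc x hy

lemma CrossesOnly.dist_eq (hc : G.CrossesOnly S s t) (hG : G.Connected) (hst : G.Adj s t)
    {x y : V} (hx : x ∈ S) (hy : y ∉ S) :
    G.dist x y = G.dist x s + 1 + G.dist t y := by
  apply le_antisymm _ (hc.le_dist hG hG (fun _ _ _ h => h) hx hy)
  have h1 := hG.dist_triangle (u := x) (v := s) (w := y)
  have h2 := hG.dist_le_succ hst y
  omega

/-- In a tree, deleting the edge `pq` splits off a side `S ∋ q`, and the two sides can be joined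
again by any other edge between them. -/
lemma IsAcyclic.exists_side (hG : G.Connected) (ha : G.IsAcyclic) {p q : V} (hpq : G.Adj p q) :
    ∃ S : Set V, q ∈ S ∧ p ∉ S ∧ G.CrossesOnly S q p ∧ ∀ s ∈ S, ∀ t ∉ S,
      ∃ K : SimpleGraph V, K.Connected ∧ K ≤ G ⊔ edge s t ∧
        (∀ z w, (z ∈ S ↔ w ∈ S) → K.Adj z w → G.Adj z w) ∧ K.CrossesOnly S s t := by
  set D := G.deleteEdges {s(p, q)} with hD
  have hbr : ¬ D.Reachable p q := isBridge_iff.mp (isAcyclic_iff_forall_adj_isBridge.mp ha hpq)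
  have hadj : ∀ x y, G.Adj x y → D.Adj x y ∨ (x = p ∧ y = q) ∨ (x = q ∧ y = p) := by
    intro x y h
    by_cases h' : s(x, y) = s(p, q)
    · right
      simpa using h'
    · left
      simp [hD, deleteEdges_adj, h]
      simpa using h'
  have hcov : ∀ x, ¬ D.Reachable q x → D.Reachable p x := by
    intro x hx
    by_contra hp
    obtain ⟨w⟩ := hG.preconnected x q
    obtain ⟨d, -, hd1, hd2⟩ := w.exists_boundary_dart {z | ¬ D.Reachable q z ∧ ¬ D.Reachable p z}
      ⟨hx, hp⟩ (fun h => h.1 (Reachable.refl _))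
    simp only [Set.mem_ofPred_eq] at hd1 hd2
    rcases hadj _ _ d.adj with h | ⟨h, -⟩ | ⟨h, -⟩
    · exact hd2 ⟨fun h' => hd1.1 (h'.trans h.symm.reachable),
        fun h' => hd1.2 (h'.trans h.symm.reachable)⟩
    · exact hd1.2 (h ▸ Reachable.refl _)
    · exact hd1.1 (h ▸ Reachable.refl _)
  have hDS : ∀ x y, D.Reachable q x → ¬ D.Reachable q y → ¬ D.Adj x y :=
    fun x y hx hy h => hy (hx.trans h.reachable)
  refine ⟨{z | D.Reachable q z}, Reachable.refl _, fun h => hbr h.symm, ?_, ?_⟩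
  · intro x hx y hy hxy
    rcases hadj x y hxy with h | ⟨rfl, rfl⟩ | h
    · exact absurd h (hDS x y hx hy)
    · exact absurd hx.symm hbr
    · exact h
  · intro s hs t ht
    simp only [Set.mem_ofPred_eq] at hs ht
    have hst : s ≠ t := by
      rintro rfl
      exact ht hs
    have hDG : D ≤ G := deleteEdges_le _
    have hDK : D ≤ D ⊔ edge s t := le_sup_left
    have hsq : (D ⊔ edge s t).Adj s t := by simp [edge_adj, hst]
    refine ⟨D ⊔ edge s t, ?_, sup_le_sup_right hDG _, ?_, ?_⟩
    · have hq : ∀ z, (D ⊔ edge s t).Reachable q z := by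
        intro z
        by_cases hz : D.Reachable q z
        · exact hz.mono hDK
        · exact (hs.mono hDK).trans (hsq.reachable.trans
            (((hcov t ht).symm.trans (hcov z hz)).mono hDK))
      have : Nonempty V := ⟨q⟩
      exact ⟨fun x y => (hq x).symm.trans (hq y)⟩
    · intro z w hzw h
      rcases h with h | h
      · exact hDG h
      · rw [edge_adj] at h
        simp only [Set.mem_ofPred_eq] at hzw
        rcases h.1 with ⟨rfl, rfl⟩ | ⟨rfl, rfl⟩ <;> tauto
    · intro x hx y hy hxy
      simp only [Set.mem_ofPred_eq] at hx hy
      rcases hxy with h | h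
      · exact absurd h (hDS x y hx hy)
      · rw [edge_adj] at h
        rcases h.1 with h | ⟨rfl, rfl⟩
        · exact ⟨h.1, h.2⟩
        · exact absurd hx ht

end Cut

lemma Connected.exists_adj_of_mem_of_notMem {H : SimpleGraph V} (hH : H.Connected) {Q : Set V}
    {u v : V} (hu : u ∈ Q) (hv : v ∉ Q) : ∃ x y, H.Adj x y ∧ x ∈ Q ∧ y ∉ Q := by
  obtain ⟨w⟩ := hH.preconnected u v
  obtain ⟨d, -, h1, h2⟩ := w.exists_boundary_dart Q hu hv
  exact ⟨_, _, d.adj, h1, h2⟩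

/-- A connected finite graph with a leaf and without vertices of degree at least three is a path. -/
lemma Connected.nonempty_iso_pathGraph [Fintype V] {G : SimpleGraph V} (hG : G.Connected) {u : V}
    (hu : ∀ a b, G.Adj u a → G.Adj u b → a = b)
    (hdeg : ∀ v a b c, G.Adj v a → G.Adj v b → G.Adj v c → a = b ∨ b = c ∨ a = c) :
    Nonempty (G ≃g pathGraph (Fintype.card V)) := by
  have hlt : ∀ z, G.dist u z < Fintype.card V := by
    intro z
    obtain ⟨p, hp, hl⟩ := hG.exists_path_of_dist u z
    exact hl ▸ hp.length_lt
  have hpred : ∀ z k, G.dist u z = k + 1 → ∃ w, G.Adj w z ∧ G.dist u w = k := by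
    intro z k hz
    obtain ⟨p, hp⟩ := hG.exists_walk_length_eq_dist z u
    rw [dist_comm, hz] at hp
    cases p with
    | nil => simp at hp
    | @cons _ w _ h p =>
      refine ⟨w, h.symm, ?_⟩
      have h1 := dist_le p
      have h2 := hG.dist_le_succ h u
      rw [dist_comm (u := z), dist_comm (u := w)] at h2
      rw [dist_comm (v := u)] at h1
      rw [Walk.length_cons] at hp
      omega
  have hinj : ∀ k x y, G.dist u x = k → G.dist u y = k → x = y := by
    intro k
    induction k with
    | zero =>
      intro x y hx hy
      rw [hG.dist_eq_zero_iff] at hx hy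
      rw [← hx, ← hy]
    | succ k ih =>
      intro x y hx hy
      obtain ⟨w, hwx, hw⟩ := hpred x k hx
      obtain ⟨w', hwy, hw'⟩ := hpred y k hy
      obtain rfl := ih w w' hw hw'
      cases k with
      | zero =>
        rw [hG.dist_eq_zero_iff] at hw
        subst hw
        exact hu x y hwx hwy
      | succ k =>
        obtain ⟨t, htw, ht⟩ := hpred w k hw
        rcases hdeg w x y t hwx hwy htw.symm with h | rfl | rfl
        · exact h
        · omega
        · omega
  let g : V → Fin (Fintype.card V) := fun z => ⟨G.dist u z, hlt z⟩
  have hg : Function.Injective g := fun x y h => hinj _ x y rfl (Fin.mk.inj h).symm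
  have hbij : Function.Bijective g :=
    (Fintype.bijective_iff_injective_and_card g).mpr ⟨hg, by simp⟩
  refine ⟨⟨Equiv.ofBijective g hbij, ?_⟩⟩
  intro x y
  have hsucc : ∀ x y, G.dist u x + 1 = G.dist u y → G.Adj x y := by
    intro x y h
    obtain ⟨w, hw, hwd⟩ := hpred y _ h.symm
    exact hinj _ _ _ hwd rfl ▸ hw
  rw [pathGraph_adj]
  simp only [Equiv.ofBijective_apply, g]
  constructor
  · rintro (h | h)
    · exact hsucc x y h
    · exact (hsucc y x h).symm
  · intro h
    have h1 := hG.dist_le_succ h u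
    have h2 := hG.dist_le_succ h.symm u
    have h3 : G.dist u x ≠ G.dist u y := fun h' => h.ne (hinj _ _ _ h' rfl)
    rw [dist_comm (u := x), dist_comm (u := y)] at h1 h2
    omega

end SimpleGraph

section UpperHamiltonian

variable {α β : Type} [Fintype α] {H : SimpleGraph α} {f : α ≃ β}

lemma sH_le_sH {γ : Type} {G : SimpleGraph β} {K : SimpleGraph γ} {f : α → β} {g : α → γ}
    (h : ∀ x y, H.Adj x y → G.dist (f x) (f y) ≤ K.dist (g x) (g y)) :
    sH H G f ≤ sH H K g := by
  unfold sH
  refine Finset.sum_le_sum fun e he => ?_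
  induction e with
  | h x y => exact h x y (by simpa using he)

lemma dist_eq_of_sH_le {G K : SimpleGraph β} {f : α → β}
    (h : ∀ x y, H.Adj x y → G.dist (f x) (f y) ≤ K.dist (f x) (f y))
    (hs : sH H K f ≤ sH H G f) {x y : α} (hxy : H.Adj x y) :
    K.dist (f x) (f y) = G.dist (f x) (f y) := by
  have heq := le_antisymm (sH_le_sH h) hs
  unfold sH at heq
  rw [Finset.sum_eq_sum_iff_of_le] at heq
  · exact (heq s(x, y) (by simpa using hxy)).symm
  · intro e he
    induction e with
    | h x y => exact h x y (by simpa using he)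

lemma card_mul_sH_lt_sum {ι : Type} [Fintype ι] {G : SimpleGraph β} {K : ι → SimpleGraph β}
    {f : α → β}
    (h : ∀ x y, Fintype.card ι * G.dist x y ≤ ∑ i, (K i).dist x y)
    {x y : α} (hxy : H.Adj x y)
    (hlt : Fintype.card ι * G.dist (f x) (f y) < ∑ i, (K i).dist (f x) (f y)) :
    Fintype.card ι * sH H G f < ∑ i, sH H (K i) f := by
  unfold sH
  rw [Finset.sum_comm, Finset.mul_sum]
  refine Finset.sum_lt_sum (fun e _ => ?_) ⟨s(x, y), by simpa using hxy, hlt⟩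
  induction e with
  | h x y => exact h _ _

/-- Sliding the branch at `v` through `a` along the edge `vc`: the distances from that branch `A`
to the branch `C` through `c` drop by at most one, those to all other vertices grow. -/
lemma SimpleGraph.CrossesOnly.exists_slide {G : SimpleGraph β} (hG : G.Connected) {v a c : β}
    {A C : Set β} (hvc : G.Adj v c) (haA : a ∈ A) (hcA : c ∉ A) (hcC : c ∈ C)
    (hva : G.Adj v a) (hA : G.CrossesOnly A a v) (hC : G.CrossesOnly C c v)
    (hswap : ∀ s ∈ A, ∀ t ∉ A, ∃ K : SimpleGraph β, K.Connected ∧ K ≤ G ⊔ edge s t ∧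
      (∀ z w, (z ∈ A ↔ w ∈ A) → K.Adj z w → G.Adj z w) ∧ K.CrossesOnly A s t) :
    ∃ K : SimpleGraph β, K.Connected ∧ ∀ x y,
      ((x ∈ A ↔ y ∈ A) → G.dist x y ≤ K.dist x y) ∧
      G.dist x y ≤ K.dist x y + 1 ∧
      (x ∈ A → y ∉ A → y ∉ C → G.dist x y + 1 ≤ K.dist x y) ∧
      (y ∈ A → x ∉ A → x ∉ C → G.dist x y + 1 ≤ K.dist x y) := by
  obtain ⟨K, hK, -, hin, hc⟩ := hswap a haA c hcA
  have drop : ∀ x ∈ A, ∀ y ∉ A, G.dist x y ≤ K.dist x y + 1 := by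
    intro x hx y hy
    have h1 := hc.le_dist hG hK hin hx hy
    have h2 := hA.dist_eq hG hva.symm hx hy
    have h3 := hG.dist_le_succ hvc y
    omega
  have grow : ∀ x ∈ A, ∀ y ∉ A, y ∉ C → G.dist x y + 1 ≤ K.dist x y := by
    intro x hx y hy hyC
    have h1 := hc.le_dist hG hK hin hx hy
    have h2 := hA.dist_eq hG hva.symm hx hy
    have h3 := hC.dist_eq hG hvc.symm hcC hyC
    rw [dist_self] at h3
    omega
  refine ⟨K, hK, fun x y => ⟨fun h => hc.dist_le_dist hG hK hin h, ?_,
    fun hx => grow x hx y, fun hy hx hxC => ?_⟩⟩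
  · by_cases hx : x ∈ A <;> by_cases hy : y ∈ A
    · exact (hc.dist_le_dist hG hK hin (by simp [hx, hy])).trans (Nat.le_succ _)
    · exact drop x hx y hy
    · rw [dist_comm, dist_comm (G := K)]
      exact drop y hy x hx
    · exact (hc.dist_le_dist hG hK hin (by simp [hx, hy])).trans (Nat.le_succ _)
  · rw [dist_comm, dist_comm (G := K)]
    exact grow y hy x hx hxC

lemma SimpleGraph.CrossesOnly.disjoint {G : SimpleGraph β} (hG : G.Connected) {v a c : β}
    {A C : Set β} (hva : G.Adj v a) (hvc : G.Adj v c) (hA : G.CrossesOnly A a v)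
    (hC : G.CrossesOnly C c v) (haC : a ∉ C) (hcA : c ∉ A) {z : β} (hzA : z ∈ A) : z ∉ C := by
  intro hzC
  have h1 := hA.dist_eq hG hva.symm hzA hcA
  have h2 := hC.dist_eq hG hvc.symm hzC haC
  have h3 := hG.pos_dist_of_ne hvc.ne
  have h4 := hG.pos_dist_of_ne hva.ne
  omega

/-- A tree maximizing the sum along a connected graph `H` has maximum degree at most two. -/
lemma not_three_neighbors_of_forall_sH_le {G : SimpleGraph β} (hH : H.Connected) (hG : G.Connected)
    (ha : G.IsAcyclic) (hmax : ∀ K : SimpleGraph β, K.Connected → sH H K f ≤ sH H G f)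
    (v a b c : β) (hva : G.Adj v a) (hvb : G.Adj v b) (hvc : G.Adj v c) :
    a = b ∨ b = c ∨ a = c := by
  by_contra! hne
  obtain ⟨hab, hbc, hac⟩ := hne
  obtain ⟨A, haA, hvA, hA, hAs⟩ := ha.exists_side hG hva
  obtain ⟨B, hbB, hvB, hB, hBs⟩ := ha.exists_side hG hvb
  obtain ⟨C, hcC, hvC, hC, hCs⟩ := ha.exists_side hG hvc
  have hbA : b ∉ A := fun h => hab (hA b h v hvA hvb.symm).1.symm
  have hcA : c ∉ A := fun h => hac (hA c h v hvA hvc.symm).1.symm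
  have haB : a ∉ B := fun h => hab (hB a h v hvB hva.symm).1
  have hcB : c ∉ B := fun h => hbc (hB c h v hvB hvc.symm).1.symm
  have haC : a ∉ C := fun h => hac (hC a h v hvC hva.symm).1
  have hbC : b ∉ C := fun h => hbc (hC b h v hvC hvb.symm).1
  have dAB : ∀ z ∈ A, z ∉ B := fun z hz => hA.disjoint hG hva hvb hB haB hbA hz
  have dAC : ∀ z ∈ A, z ∉ C := fun z hz => hA.disjoint hG hva hvc hC haC hcA hz
  have dBC : ∀ z ∈ B, z ∉ C := fun z hz => hB.disjoint hG hvb hvc hC hbC hcB hz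
  have region : ∀ z, (z ∈ A ∧ z ∉ B ∧ z ∉ C) ∨ (z ∉ A ∧ z ∈ B ∧ z ∉ C) ∨
      (z ∉ A ∧ z ∉ B ∧ z ∈ C) ∨ (z ∉ A ∧ z ∉ B ∧ z ∉ C) := by
    intro z
    have h1 := dAB z
    have h2 := dAC z
    have h3 := dBC z
    clear * - h1 h2 h3
    tauto
  obtain ⟨K₁, hK₁, h₁⟩ := hA.exists_slide hG hvb haA hbA hbB hva hB hAs
  obtain ⟨K₂, hK₂, h₂⟩ := hA.exists_slide hG hvc haA hcA hcC hva hC hAs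
  obtain ⟨K₃, hK₃, h₃⟩ := hB.exists_slide hG hva hbB haB haA hvb hA hBs
  obtain ⟨K₄, hK₄, h₄⟩ := hB.exists_slide hG hvc hbB hcB hcC hvb hC hBs
  obtain ⟨K₅, hK₅, h₅⟩ := hC.exists_slide hG hva hcC haC haA hvc hA hCs
  obtain ⟨K₆, hK₆, h₆⟩ := hC.exists_slide hG hvb hcC hbC hbB hvc hB hCs
  obtain ⟨x, y, hxy, hx, hy⟩ := hH.exists_adj_of_mem_of_notMem
    (Q := {z | f z ∈ A ∨ f z ∈ B ∨ f z ∈ C}) (u := f.symm a) (v := f.symm v)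
    (by simp [haA]) (by simp [hvA, hvB, hvC])
  simp only [Set.mem_ofPred_eq, not_or] at hx hy
  have key : ∀ x y, 6 * G.dist x y ≤ K₁.dist x y + K₂.dist x y + K₃.dist x y + K₄.dist x y +
      K₅.dist x y + K₆.dist x y ∧ ((x ∈ A ∨ x ∈ B ∨ x ∈ C) → y ∉ A ∧ y ∉ B ∧ y ∉ C →
      6 * G.dist x y < K₁.dist x y + K₂.dist x y + K₃.dist x y + K₄.dist x y +
      K₅.dist x y + K₆.dist x y) := by
    intro x y
    obtain ⟨p₁, q₁, r₁, s₁⟩ := h₁ x y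
    obtain ⟨p₂, q₂, r₂, s₂⟩ := h₂ x y
    obtain ⟨p₃, q₃, r₃, s₃⟩ := h₃ x y
    obtain ⟨p₄, q₄, r₄, s₄⟩ := h₄ x y
    obtain ⟨p₅, q₅, r₅, s₅⟩ := h₅ x y
    obtain ⟨p₆, q₆, r₆, s₆⟩ := h₆ x y
    have rx := region x
    have ry := region y
    clear h₁ h₂ h₃ h₄ h₅ h₆ region dAB dAC dBC
    generalize G.dist x y = d at *
    generalize K₁.dist x y = d₁ at *
    generalize K₂.dist x y = d₂ at *
    generalize K₃.dist x y = d₃ at *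
    generalize K₄.dist x y = d₄ at *
    generalize K₅.dist x y = d₅ at *
    generalize K₆.dist x y = d₆ at *
    rcases rx with ⟨x1, x2, x3⟩ | ⟨x1, x2, x3⟩ | ⟨x1, x2, x3⟩ | ⟨x1, x2, x3⟩ <;>
      rcases ry with ⟨y1, y2, y3⟩ | ⟨y1, y2, y3⟩ | ⟨y1, y2, y3⟩ | ⟨y1, y2, y3⟩ <;>
      simp [x1, x2, x3, y1, y2, y3] at p₁ p₂ p₃ p₄ p₅ p₆ r₁ r₂ r₃ r₄ r₅ r₆ s₁ s₂ s₃ s₄ s₅ s₆ ⊢ <;>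
      omega
  have hlt := card_mul_sH_lt_sum (H := H) (G := G) (K := ![K₁, K₂, K₃, K₄, K₅, K₆]) (f := f)
    (by simpa [Fin.sum_univ_succ, add_assoc] using fun x y => (key x y).1) hxy
    (by simpa [Fin.sum_univ_succ, add_assoc] using (key _ _).2 hx hy)
  simp only [Fintype.card_fin, Fin.sum_univ_six] at hlt
  simp at hlt
  have := hmax _ hK₁
  have := hmax _ hK₂
  have := hmax _ hK₃
  have := hmax _ hK₄
  have := hmax _ hK₅
  have := hmax _ hK₆
  omega

/-- Along a geodesic on which `φ` increases from start to end, some edge increases `φ`. -/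
lemma SimpleGraph.Connected.exists_adj_lt_of_lt {G : SimpleGraph β} (hG : G.Connected) {φ : β → ℤ}
    {x y : β} (h : φ y < φ x) : ∃ p q, G.Adj p q ∧ φ p < φ q ∧
      G.dist y p + 1 + G.dist q x ≤ G.dist y x := by
  obtain ⟨w, hw⟩ := hG.exists_walk_length_eq_dist y x
  rw [← hw]
  clear hw
  induction w with
  | nil => exact absurd h (lt_irrefl _)
  | @cons y z x hyz w ih =>
    rw [Walk.length_cons]
    by_cases hz : φ y < φ z
    · refine ⟨y, z, hyz, hz, ?_⟩
      have := dist_le w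
      rw [dist_self]
      omega
    · obtain ⟨p, q, hpq, hlt, hle⟩ := ih (by omega)
      refine ⟨p, q, hpq, hlt, ?_⟩
      have := hG.dist_le_succ hyz p
      omega

/-- A connected graph maximizing the sum along a connected graph `H` is acyclic. -/
lemma isAcyclic_of_forall_sH_le {G : SimpleGraph β} (hH : H.Connected) (hG : G.Connected)
    (hmax : ∀ K : SimpleGraph β, K.Connected → sH H K f ≤ sH H G f) : G.IsAcyclic := by
  obtain ⟨T, hTG, hT⟩ := hG.exists_isTree_le
  have hTc := hT.connected
  suffices h : G ≤ T from le_antisymm h hTG ▸ hT.isAcyclic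
  by_contra hnot
  obtain ⟨u, v, huv, hTuv⟩ : ∃ u v, G.Adj u v ∧ ¬ T.Adj u v := by
    by_contra! h
    exact hnot fun u v => h u v
  have hsub : ∀ K : SimpleGraph β, K.Connected → K ≤ G → ∀ {x y}, H.Adj x y →
      K.dist (f x) (f y) = G.dist (f x) (f y) := fun K hK hKG x y hxy =>
    dist_eq_of_sH_le (fun x y _ => (hK _ _).dist_anti hKG) (hmax K hK) hxy
  have hm : 2 ≤ T.dist u v := hTc.one_lt_dist_of_ne_of_not_adj huv.ne hTuv
  set φ : β → ℤ := fun z => T.dist z u - T.dist z v with hφ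
  have jump : ∀ x y, H.Adj x y → φ (f y) < φ (f x) → φ (f x) - φ (f y) = T.dist u v + 1 := by
    intro x y hxy hlt
    obtain ⟨p, q, hpq, hφpq, hgeo⟩ := hTc.exists_adj_lt_of_lt hlt
    obtain ⟨S, hqS, hpS, hS, hswap⟩ := hT.isAcyclic.exists_side hTc hpq
    have hq : ∀ z ∈ S, T.dist p z = T.dist q z + 1 := by
      intro z hz
      have := hS.dist_eq hTc hpq.symm hz hpS
      rw [dist_comm (u := p), dist_comm (u := q), this, dist_self]
    have hp : ∀ z ∉ S, T.dist q z = T.dist p z + 1 := by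
      intro z hz
      have := hS.dist_eq hTc hpq.symm hqS hz
      rw [this, dist_self]
      omega
    have hu : u ∉ S := by
      intro hu
      have h1 := hq u hu
      simp only [hφ] at hφpq
      by_cases hv : v ∈ S
      · have := hq v hv
        omega
      · have := hp v hv
        omega
    have hv : v ∈ S := by
      by_contra hv
      have h1 := hp u hu
      have h2 := hp v hv
      simp only [hφ] at hφpq
      omega
    have hy : f y ∉ S := by
      intro hy
      have h1 := hq _ hy
      have h2 := hTc.dist_triangle (u := f y) (v := q) (w := f x)
      rw [dist_comm (u := f y) (v := p)] at hgeo
      rw [dist_comm (u := f y) (v := q)] at h2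
      omega
    have hx : f x ∈ S := by
      by_contra hx
      have h1 := hp _ hx
      have h2 := hTc.dist_triangle (u := f y) (v := p) (w := f x)
      omega
    obtain ⟨K, hK, hKle, hin, hc⟩ := hswap v hv u hu
    have hKG : K ≤ G := hKle.trans (sup_le hTG (by rw [edge_le_iff]; exact Or.inr huv.symm))
    have e1 := hsub K hK hKG hxy
    have e2 := hsub T hTc hTG hxy
    have e3 := hc.le_dist hTc hK hin hx hy
    have e4 := hG.dist_triangle (u := f x) (v := v) (w := f y)
    have e5 := hG.dist_le_succ huv.symm (f y)
    have e6 := (hTc (f x) v).dist_anti hTG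
    have e7 := (hTc u (f y)).dist_anti hTG
    have d1 := hS.dist_eq hTc hpq.symm hx hy
    have d2 := hS.dist_eq hTc hpq.symm hx hu
    have d3 := hS.dist_eq hTc hpq.symm hv hy
    have d4 := hS.dist_eq hTc hpq.symm hv hu
    simp only [hφ]
    rw [dist_comm (u := u) (v := v), dist_comm (u := f y) (v := v),
      dist_comm (u := f y) (v := u)]
    omega
  have hφu : φ u = -T.dist u v := by simp [hφ]
  have hφv : φ v = T.dist u v := by simp [hφ, dist_comm]
  have hbound : ∀ z, -(T.dist u v : ℤ) ≤ φ z ∧ φ z ≤ T.dist u v := by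
    intro z
    have h1 := hTc.dist_triangle (u := z) (v := u) (w := v)
    have h2 := hTc.dist_triangle (u := z) (v := v) (w := u)
    rw [dist_comm (u := v) (v := u)] at h2
    simp only [hφ]
    omega
  obtain ⟨x, y, hxy, hx, hy⟩ := hH.exists_adj_of_mem_of_notMem
    (Q := {z | φ (f z) = -T.dist u v ∨ φ (f z) = 1}) (u := f.symm u) (v := f.symm v)
    (by simp [hφu]) (by
      simp only [Set.mem_ofPred_eq, Equiv.apply_symm_apply, hφv]
      omega)
  simp only [Set.mem_ofPred_eq] at hx hy
  have h1 := hbound (f x)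
  have h2 := hbound (f y)
  rcases lt_trichotomy (φ (f x)) (φ (f y)) with h | h | h
  · have := jump y x hxy.symm h
    omega
  · omega
  · have := jump x y hxy h
    omega

lemma nonempty_iso_pathGraph_of_forall_sH_le [Fintype β] {G : SimpleGraph β} (hH : H.Connected)
    (hG : G.Connected) (h2 : 2 ≤ Fintype.card β)
    (hmax : ∀ K : SimpleGraph β, K.Connected → sH H K f ≤ sH H G f) :
    Nonempty (G ≃g pathGraph (Fintype.card β)) := by
  classical
  have ha := isAcyclic_of_forall_sH_le hH hG hmax
  have : Nontrivial β := Fintype.one_lt_card_iff_nontrivial.mp h2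
  obtain ⟨u, hu⟩ := IsTree.exists_vert_degree_one_of_nontrivial ⟨hG, ha⟩
  rw [degree_eq_one_iff_existsUnique_adj] at hu
  exact hG.nonempty_iso_pathGraph (fun a b h h' => hu.unique h h')
    (not_three_neighbors_of_forall_sH_le hH hG ha hmax)

lemma sH_le_upperHH {γ : Type} (K : SimpleGraph γ) (g : α ≃ γ) : sH H K g ≤ upperHH H K := by
  have : Finite γ := Finite.of_equiv α g
  have : Finite (α ≃ γ) := DFunLike.finite _
  exact le_csSup (Set.finite_range fun g : α ≃ γ => sH H K g).bddAbove ⟨g, rfl⟩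

lemma exists_sH_eq_upperHH {γ : Type} (K : SimpleGraph γ) (g : α ≃ γ) :
    ∃ f : α ≃ γ, sH H K f = upperHH H K := by
  have : Finite γ := Finite.of_equiv α g
  have : Finite (α ≃ γ) := DFunLike.finite _
  exact Nat.sSup_mem (s := {m | ∃ f : α ≃ γ, sH H K f = m}) ⟨_, g, rfl⟩
    (Set.finite_range fun g : α ≃ γ => sH H K g).bddAbove

lemma SimpleGraph.Iso.connected_dist_le {γ : Type} {G : SimpleGraph β} {K : SimpleGraph γ}
    (hG : G.Connected) (φ : G ≃g K) (x y : β) : K.dist (φ x) (φ y) ≤ G.dist x y := by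
  obtain ⟨p, hp⟩ := hG.exists_walk_length_eq_dist x y
  rw [← hp, ← p.length_map φ.toHom]
  exact dist_le _

lemma SimpleGraph.Iso.sH_le {γ : Type} {G : SimpleGraph β} {K : SimpleGraph γ}
    (hG : G.Connected) (φ : G ≃g K) (f : α ≃ β) : sH H G f ≤ upperHH H K := by
  have hK : K.Connected := φ.connected_iff.mp hG
  refine le_trans (sH_le_sH fun x y _ => ?_) (sH_le_upperHH K (f.trans φ.toEquiv))
  simpa using φ.symm.connected_dist_le hK (φ (f x)) (φ (f y))

lemma SimpleGraph.Iso.upperHH_le {γ : Type} {G : SimpleGraph β} {K : SimpleGraph γ}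
    (hG : G.Connected) (φ : G ≃g K) (f : α ≃ β) : upperHH H G ≤ upperHH H K := by
  obtain ⟨g, hg⟩ := exists_sH_eq_upperHH (H := H) G f
  exact hg ▸ φ.sH_le hG g

end UpperHamiltonian

theorem stmt13 {α β : Type} [Fintype α] [Fintype β]
    (H : SimpleGraph α) (G : SimpleGraph β) (hH : H.Connected) (hG : G.Connected)
    (hcard : Fintype.card α = Fintype.card β) (h2 : 2 ≤ Fintype.card β) :
    upperHH H G ≤ upperHH H (pathGraph (Fintype.card β)) ∧
    (upperHH H G = upperHH H (pathGraph (Fintype.card β)) ↔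
      Nonempty (G ≃g pathGraph (Fintype.card β))) := by
  obtain ⟨f, hf⟩ := exists_sH_eq_upperHH (H := H) G (Fintype.equivOfCardEq hcard)
  obtain ⟨K, hK, hKmax⟩ := Set.exists_max_image {K : SimpleGraph β | K.Connected}
    (fun K => sH H K f) (Set.toFinite _) ⟨G, hG⟩
  obtain ⟨φ⟩ := nonempty_iso_pathGraph_of_forall_sH_le hH hK h2 hKmax
  have hGK : sH H G f ≤ sH H K f := hKmax G hG
  have hKP := φ.sH_le (H := H) hK f
  refine ⟨by omega, fun heq => ?_, fun ⟨ψ⟩ => le_antisymm (by omega) ?_⟩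
  · refine nonempty_iso_pathGraph_of_forall_sH_le (f := f) hH hG h2 fun K' hK' => ?_
    have := hKmax K' hK'
    omega
  · exact ψ.symm.upperHH_le (ψ.connected_iff.mp hG) (f.trans ψ.toEquiv)
end

section
/- For every n ≥ 2, the upper traceable number of the path on n vertices satisfies t⁺(P_{n−1}) = ⌊n²/2⌋ − 1. -/
open SimpleGraph

/-- The distance in a path graph is the absolute difference of the labels. -/
theorem pathGraph_dist {n : ℕ} (u v : Fin n) :
    (pathGraph n).dist u v = ((u : ℤ) - v).natAbs := by
  apply le_antisymm
  · have key : ∀ (d : ℕ) (u v : Fin n), u.val + d = v.val → (pathGraph n).dist u v ≤ d := by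
      intro d
      induction d with
      | zero =>
        intro u v h
        obtain rfl : u = v := Fin.ext (by omega)
        simp
      | succ d ih =>
        intro u v h
        have hw : u.val + d < n := by omega
        have hadj : (pathGraph n).Adj ⟨u.val + d, hw⟩ v := by
          rw [pathGraph_adj]
          left
          simp only
          omega
        have h1 := ih u ⟨u.val + d, hw⟩ rfl
        have h2 := (pathGraph_preconnected n u ⟨u.val + d, hw⟩).dist_triangle_left v
        have h3 := dist_eq_one_iff_adj.mpr hadj
        omega
    rcases le_total u.val v.val with h | h
    · exact key _ u v (by omega)
    · rw [dist_comm]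
      exact key _ v u (by omega)
  · obtain ⟨w, hw⟩ := (pathGraph_preconnected n u v).exists_walk_length_eq_dist
    rw [← hw]
    clear hw
    induction w with
    | nil => simp
    | cons h p ih =>
      rw [pathGraph_adj] at h
      rw [Walk.length_cons]
      omega

theorem openSum_succ {V : Type} {m : ℕ} (G : SimpleGraph V) (f : Fin (m + 1) → V) :
    openSum G f = ∑ i : Fin m, G.dist (f i.castSucc) (f i.succ) := by
  unfold openSum
  rw [Fin.sum_univ_castSucc]
  simp [Fin.succ]

/-- The sum of twice the distances of `0, …, n - 1` to their centre. -/
theorem sum_range_natAbs_centered (n : ℕ) :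
    ∑ k ∈ Finset.range n, (2 * (k : ℤ) + 1 - n).natAbs = n ^ 2 / 2 := by
  induction n using Nat.twoStepInduction with
  | zero => simp
  | one => simp
  | more n ih _ =>
    rw [Finset.sum_range_succ, Finset.sum_range_succ']
    have hshift : ∀ k ∈ Finset.range n,
        (2 * ((k + 1 : ℕ) : ℤ) + 1 - ((n + 2 : ℕ) : ℤ)).natAbs
          = (2 * (k : ℤ) + 1 - n).natAbs := by
      intro k _
      congr 1
      push_cast
      ring
    rw [Finset.sum_congr rfl hshift, ih, show (n + 2) ^ 2 = n ^ 2 + 2 * (2 * n + 2) by ring]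
    omega

theorem openSum_pathGraph_le (m : ℕ) (hm : 1 ≤ m) (f : Fin (m + 1) ≃ Fin (m + 1)) :
    openSum (pathGraph (m + 1)) f ≤ (m + 1) ^ 2 / 2 - 1 := by
  set b : Fin (m + 1) → ℕ := fun i => (2 * ((f i : ℕ) : ℤ) + 1 - (m + 1 : ℕ)).natAbs with hb
  have htotal : ∑ i, b i = (m + 1) ^ 2 / 2 := by
    rw [← sum_range_natAbs_centered, ← Fin.sum_univ_eq_sum_range
      (fun k => (2 * (k : ℤ) + 1 - (m + 1 : ℕ)).natAbs)]
    exact Equiv.sum_comp f (fun k : Fin (m + 1) => (2 * ((k : ℕ) : ℤ) + 1 - (m + 1 : ℕ)).natAbs)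
  have hstep : 2 * openSum (pathGraph (m + 1)) f
      ≤ ∑ i : Fin m, b i.castSucc + ∑ i : Fin m, b i.succ := by
    rw [openSum_succ, Finset.mul_sum, ← Finset.sum_add_distrib]
    refine Finset.sum_le_sum fun i _ => ?_
    rw [pathGraph_dist]
    simp only [hb]
    omega
  have hlast := Fin.sum_univ_castSucc b
  have hfirst := Fin.sum_univ_succ b
  have hends : 2 ≤ b 0 + b (Fin.last m) := by
    have hne : (f 0).val ≠ (f (Fin.last m)).val := by
      intro h
      have h0 := congrArg Fin.val (f.injective (Fin.ext h))
      simp at h0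
      omega
    simp only [hb]
    omega
  omega

theorem exists_openSum_even (k : ℕ) :
    ∃ f : Fin (2 * k + 1 + 1) ≃ Fin (2 * k + 1 + 1),
      openSum (pathGraph (2 * k + 1 + 1)) f = (2 * k + 1 + 1) ^ 2 / 2 - 1 := by
  let g : Fin (2 * k + 1 + 1) → Fin (2 * k + 1 + 1) := fun i =>
    ⟨if i.val % 2 = 0 then k + 1 + i.val / 2 else i.val / 2, by split_ifs <;> omega⟩
  have hg : Function.Injective g := by
    intro i j h
    have h' := congrArg Fin.val h
    simp only [g] at h'
    apply Fin.ext
    split_ifs at h' <;> omega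
  refine ⟨Equiv.ofBijective g (Finite.injective_iff_bijective.mp hg), ?_⟩
  have hsum : ∀ j, ∑ i ∈ Finset.range (2 * j + 1), (if i % 2 = 0 then k + 1 else k + 2)
      = j * (2 * k + 3) + k + 1 := by
    intro j
    induction j with
    | zero => simp
    | succ j ih =>
      rw [show 2 * (j + 1) + 1 = 2 * j + 1 + 1 + 1 by ring, Finset.sum_range_succ,
        Finset.sum_range_succ, ih, if_neg (by omega), if_pos (by omega)]
      ring
  rw [openSum_succ, show (2 * k + 1 + 1) ^ 2 = 2 * (k * (2 * k + 3) + k + 1 + 1) by ring,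
    Nat.mul_div_cancel_left _ two_pos, Nat.add_sub_cancel, ← hsum, ← Fin.sum_univ_eq_sum_range]
  refine Finset.sum_congr rfl fun i _ => ?_
  simp only [pathGraph_dist, Equiv.ofBijective_apply, g, Fin.val_castSucc, Fin.val_succ]
  split_ifs <;> omega

theorem exists_openSum_odd (k : ℕ) :
    ∃ f : Fin (2 * k + 2 + 1) ≃ Fin (2 * k + 2 + 1),
      openSum (pathGraph (2 * k + 2 + 1)) f = (2 * k + 2 + 1) ^ 2 / 2 - 1 := by
  let g : Fin (2 * k + 2 + 1) → Fin (2 * k + 2 + 1) := fun i =>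
    ⟨if i.val = 0 then k + 1 else if i.val % 2 = 0 then i.val / 2 - 1 else k + 2 + i.val / 2,
      by split_ifs <;> omega⟩
  have hg : Function.Injective g := by
    intro i j h
    have h' := congrArg Fin.val h
    simp only [g] at h'
    apply Fin.ext
    split_ifs at h' <;> omega
  refine ⟨Equiv.ofBijective g (Finite.injective_iff_bijective.mp hg), ?_⟩
  have hsum : ∀ j, ∑ i ∈ Finset.range (2 * j + 2),
      (if i = 0 then 1 else if i % 2 = 0 then k + 3 else k + 2) = j * (2 * k + 5) + k + 3 := by
    intro j
    induction j with
    | zero => simp [Finset.sum_range_succ]; omega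
    | succ j ih =>
      rw [show 2 * (j + 1) + 2 = 2 * j + 2 + 1 + 1 by ring, Finset.sum_range_succ,
        Finset.sum_range_succ, ih, if_neg (by omega), if_pos (by omega), if_neg (by omega),
        if_neg (by omega)]
      ring
  rw [openSum_succ,
    show (2 * k + 2 + 1) ^ 2 = 1 + 2 * (k * (2 * k + 5) + k + 3 + 1) by ring,
    Nat.add_mul_div_left _ _ two_pos, Nat.div_eq_of_lt one_lt_two, zero_add,
    Nat.add_sub_cancel, ← hsum, ← Fin.sum_univ_eq_sum_range]
  refine Finset.sum_congr rfl fun i _ => ?_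
  simp only [pathGraph_dist, Equiv.ofBijective_apply, g, Fin.val_castSucc, Fin.val_succ]
  split_ifs <;> first | contradiction | omega

theorem stmt15 (n : ℕ) (hn : 2 ≤ n) :
    sSup {m | ∃ f : Fin n ≃ Fin n, openSum (pathGraph n) ⇑f = m} = n ^ 2 / 2 - 1 := by
  obtain ⟨m, rfl⟩ : ∃ m, n = m + 1 := ⟨n - 1, by omega⟩
  refine IsGreatest.csSup_eq ⟨?_, ?_⟩
  · obtain ⟨k, hk⟩ | ⟨k, hk⟩ : (∃ k, m = 2 * k + 1) ∨ ∃ k, m = 2 * k + 2 := by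
      rcases Nat.even_or_odd' m with ⟨k, hk | hk⟩
      · exact Or.inr ⟨k - 1, by omega⟩
      · exact Or.inl ⟨k, hk⟩
    · subst hk
      exact exists_openSum_even k
    · subst hk
      exact exists_openSum_odd k
  · rintro _ ⟨f, rfl⟩
    exact openSum_pathGraph_le m (by omega) f
end

section
/- Let G be a connected finite simple graph with n = |V(G)| ≥ 3. Then the upper Hamiltonian number satisfies h⁺(G) ≤ ⌊n²/2⌋, and equality holds if and only if G is a path (G is isomorphic to P_{n−1}). -/
open SimpleGraph

namespace SimpleGraph

open scoped Finset

variable {V : Type} {G : SimpleGraph V}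

lemma dist_getVert_le {u v : V} (p : G.Walk u v) (k j : ℕ) :
    G.dist (p.getVert k) (p.getVert (k + j)) ≤ j := by
  have hle := SimpleGraph.dist_le ((p.drop k).take j)
  have hlen := (p.drop k).take_length j
  simp only [Walk.drop_getVert] at hle
  omega

/-- A shortest path from `c` to `u`, parametrised by the distance to `c`. -/
lemma Connected.exists_geodesic (hG : G.Connected) (c u : V) :
    ∃ x : ℕ → V, x 0 = c ∧ x (G.dist c u) = u ∧
      ∀ k l, k ≤ l → l ≤ G.dist c u → G.dist (x k) (x l) = l - k := by
  obtain ⟨p, hp⟩ := hG.exists_walk_length_eq_dist c u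
  have hx : p.getVert (G.dist c u) = u := by rw [← hp]; exact p.getVert_length
  refine ⟨p.getVert, p.getVert_zero, hx, fun k l hkl hl => ?_⟩
  have h1 := dist_getVert_le p 0 k
  have h2 := dist_getVert_le p k (l - k)
  have h3 := dist_getVert_le p l (G.dist c u - l)
  have t1 := hG.dist_triangle (u := c) (v := p.getVert k) (w := u)
  have t2 := hG.dist_triangle (u := p.getVert k) (v := p.getVert l) (w := u)
  rw [Nat.add_sub_cancel' hkl] at h2
  rw [Nat.add_sub_cancel' hl, hx] at h3
  rw [zero_add, p.getVert_zero] at h1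
  omega

lemma Connected.exists_between (hG : G.Connected) (c v : V) {k : ℕ} (hk : k ≤ G.dist c v) :
    ∃ w, G.dist c w = k ∧ G.dist w v = G.dist c v - k := by
  obtain ⟨x, h0, h1, h⟩ := hG.exists_geodesic c v
  have a := h 0 k (by omega) hk
  have b := h k _ hk le_rfl
  rw [h0] at a
  rw [h1] at b
  exact ⟨x k, by omega, b⟩

lemma Connected.exists_parent (hG : G.Connected) {c v : V} (hv : G.dist c v ≠ 0) :
    ∃ w, G.Adj w v ∧ G.dist c w + 1 = G.dist c v := by
  obtain ⟨w, h1, h2⟩ := hG.exists_between c v (Nat.sub_le (G.dist c v) 1)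
  exact ⟨w, dist_eq_one_iff_adj.mp (by omega), by omega⟩

lemma Connected.natAbs_sub_le_dist (hG : G.Connected) (φ : V → ℤ)
    (hφ : ∀ u v, G.Adj u v → (φ u - φ v).natAbs ≤ 1) (u v : V) :
    (φ u - φ v).natAbs ≤ G.dist u v := by
  obtain ⟨p, hp⟩ := hG.exists_walk_length_eq_dist u v
  rw [← hp]
  clear hp
  induction p with
  | nil => simp
  | @cons a b d h p ih =>
    have := hφ _ _ h
    rw [Walk.length_cons]
    omega

variable [Fintype V]

/-- Around a vertex of minimal eccentricity `D`, all spheres of radius `0 < k < D`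
have at least two points. -/
lemma Connected.exists_center (hG : G.Connected) :
    ∃ c u : V, (∀ v, G.dist c v ≤ G.dist c u) ∧
      ∀ k, 0 < k → k < G.dist c u → ∃ v w, v ≠ w ∧ G.dist c v = k ∧ G.dist c w = k := by
  have := hG.nonempty
  have hfar : ∀ c, ∃ u, ∀ v, G.dist c v ≤ G.dist c u := fun c => Finite.exists_max (G.dist c)
  choose far hfar using hfar
  obtain ⟨c, hc⟩ := Finite.exists_min fun c => G.dist c (far c)
  refine ⟨c, far c, hfar c, fun k hk hkD => ?_⟩
  by_contra! hno
  obtain ⟨x, hx, -⟩ := hG.exists_between c (far c) hkD.le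
  obtain ⟨c', hc', hc'x⟩ := hG.exists_between c x (k := 1) (by omega)
  have hlt : G.dist c' (far c') < G.dist c (far c) := by
    set v := far c'
    have hv := hfar c v
    rcases lt_or_ge (G.dist c v) k with h | h
    · have := hG.dist_triangle (u := c') (v := c) (w := v)
      have := G.dist_comm (u := c) (v := c')
      omega
    · obtain ⟨w, hw, hwv⟩ := hG.exists_between c v h
      have hwx : w = x := by
        by_contra hne
        exact hno w x hne hw hx
      subst hwx
      have := hG.dist_triangle (u := c') (v := w) (w := v)
      omega
  exact absurd (hc c') (by omega)

open Classical in
lemma card_ball_ge {c : V} {D : ℕ}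
    (h : ∀ k, 0 < k → k < D → ∃ v w, v ≠ w ∧ G.dist c v = k ∧ G.dist c w = k)
    (t : ℕ) (ht : t < D) : 2 * t + 1 ≤ #{v | G.dist c v ≤ t} := by
  induction t with
  | zero => exact Finset.card_pos.mpr ⟨c, by simp⟩
  | succ t ih =>
    obtain ⟨v, w, hvw, hv, hw⟩ := h (t + 1) (by omega) ht
    have hsub : (Finset.univ.filter fun v => G.dist c v ≤ t) ∪ {v, w} ⊆
        Finset.univ.filter fun v => G.dist c v ≤ t + 1 := by
      intro z
      simp only [Finset.mem_union, Finset.mem_filter, Finset.mem_univ, true_and,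
        Finset.mem_insert, Finset.mem_singleton]
      rintro (h | rfl | rfl) <;> omega
    have hdisj : Disjoint (Finset.univ.filter fun v => G.dist c v ≤ t) {v, w} := by
      simp [hv, hw]
    have := Finset.card_le_card hsub
    rw [Finset.card_union_of_disjoint hdisj, Finset.card_pair hvw] at this
    have := ih (by omega)
    omega

open Classical in
lemma sum_dist_add_sum_card_ball {c : V} {D : ℕ} (hD : ∀ v, G.dist c v ≤ D) :
    ∑ v, G.dist c v + ∑ t ∈ Finset.range D, #{v | G.dist c v ≤ t} = D * Fintype.card V := by
  have h : ∀ v, ∑ t ∈ Finset.range D, (if G.dist c v ≤ t then 1 else 0) = D - G.dist c v := by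
    intro v
    rw [← Finset.card_filter]
    have : (Finset.range D).filter (fun t => G.dist c v ≤ t) = Finset.Ico (G.dist c v) D := by
      ext t
      simp [and_comm]
    rw [this, Nat.card_Ico]
  simp_rw [Finset.card_filter]
  rw [Finset.sum_comm, ← Finset.sum_add_distrib]
  simp_rw [h, Nat.add_sub_cancel' (hD _)]
  simp [mul_comm]

lemma sum_range_two_mul_add_one (D : ℕ) : ∑ t ∈ Finset.range D, (2 * t + 1) = D * D := by
  induction D with
  | zero => rfl
  | succ D ih => rw [Finset.sum_range_succ, ih]; ring

lemma Connected.sum_dist_perm_le (hG : G.Connected) (c : V) (σ : Equiv.Perm V) :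
    ∑ v, G.dist v (σ v) ≤ 2 * ∑ v, G.dist c v := by
  calc ∑ v, G.dist v (σ v) ≤ ∑ v, (G.dist c v + G.dist c (σ v)) :=
        Finset.sum_le_sum fun v _ => by
          rw [G.dist_comm (u := c) (v := v)]; exact hG.dist_triangle
    _ = 2 * ∑ v, G.dist c v := by
        rw [Finset.sum_add_distrib, Equiv.sum_comp σ (G.dist c), two_mul]

open Classical in
/-- A cyclic set of `n ≤ 2 * m + 1` points in which `X` has at least `m` elements, no two of them
consecutive: every point outside `X` is next to a point of `X`. -/
lemma exists_neighbor_mem {X : Finset V} {σ : Equiv.Perm V} (hσ : ∀ v, σ v ≠ v)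
    (hX : ∀ v ∈ X, σ v ∉ X) (hcard : Fintype.card V ≤ 2 * X.card + 1) {y : V} (hy : y ∉ X) :
    σ y ∈ X ∨ σ.symm y ∈ X := by
  by_contra! h
  have h1 : Disjoint X (X.map σ.toEmbedding) := by
    rw [Finset.disjoint_left]
    intro v hv hv'
    obtain ⟨w, hw, rfl⟩ := Finset.mem_map.mp hv'
    exact hX w hw hv
  have h2 : Disjoint (X ∪ X.map σ.toEmbedding) {y, σ y} := by
    rw [Finset.disjoint_right]
    intro v hv
    simp only [Finset.mem_insert, Finset.mem_singleton] at hv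
    simp only [Finset.mem_union, Finset.mem_map_equiv, not_or]
    rcases hv with rfl | rfl
    · exact ⟨hy, h.2⟩
    · simpa using ⟨h.1, hy⟩
  have h3 := Finset.card_le_univ (X ∪ X.map σ.toEmbedding ∪ {y, σ y})
  rw [Finset.card_union_of_disjoint h2, Finset.card_union_of_disjoint h1, Finset.card_map,
    Finset.card_pair (hσ y).symm] at h3
  omega

lemma nonempty_iso_pathGraph_of_label (hG : G.Connected) {c : V} {m n : ℕ}
    (hn : Fintype.card V = n) (φ : V → ℤ) (hinj : Function.Injective φ)
    (habs : ∀ v, (φ v).natAbs = G.dist c v) (hadj : ∀ u v, G.Adj u v → (φ u - φ v).natAbs = 1)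
    (hlow : ∀ v, -(m : ℤ) ≤ φ v) (hup : ∀ v, φ v + m < n) :
    Nonempty (G ≃g pathGraph n) := by
  have hconv : ∀ u v, φ u + 1 = φ v ∨ φ v + 1 = φ u → (φ u).natAbs < (φ v).natAbs → G.Adj u v := by
    intro u v h hlt
    have hv := habs v
    obtain ⟨w, hw, hd⟩ := hG.exists_parent (c := c) (v := v) (by omega)
    have h1 := hadj _ _ hw
    have h2 := habs w
    have : φ w = φ u := by omega
    rwa [← hinj this]
  let g : V → Fin n := fun v => ⟨(φ v + m).toNat, by have := hlow v; have := hup v; omega⟩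
  have hg : Function.Injective g := by
    intro u v h
    have := congrArg Fin.val h
    have := hlow u
    have := hlow v
    exact hinj (by simp only [g] at *; omega)
  have hbij : Function.Bijective g :=
    (Fintype.bijective_iff_injective_and_card g).mpr ⟨hg, by simp [hn]⟩
  refine ⟨⟨Equiv.ofBijective g hbij, ?_⟩⟩
  intro u v
  have hu := hlow u
  have hv := hlow v
  rw [pathGraph_adj]
  simp only [Equiv.ofBijective_apply, g]
  constructor
  · intro h
    rcases lt_or_ge (φ u).natAbs (φ v).natAbs with hlt | hge
    · exact hconv u v (by omega) hlt
    · exact (hconv v u (by omega) (by omega)).symm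
  · intro h
    have := hadj u v h
    omega

open Classical in
/-- The extremal case: balls around `c` grow by two points at each step, and the cyclic
permutation `σ` always moves along geodesics through `c`. -/
lemma Connected.nonempty_iso_pathGraph_of_tight (hG : G.Connected) {c u : V} {n : ℕ}
    (hn : Fintype.card V = n) (h3 : 3 ≤ n) (hD : ∀ v, G.dist c v ≤ G.dist c u)
    (hball : ∀ t < G.dist c u, #{v | G.dist c v ≤ t} = 2 * t + 1)
    (hcard : n ≤ 2 * G.dist c u + 1) (σ : Equiv.Perm V) (hσ₁ : ∀ v, σ v ≠ v)
    (hσ₂ : ∀ v, σ (σ v) ≠ v) (hσ : ∀ v, G.dist v (σ v) = G.dist c v + G.dist c (σ v)) :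
    Nonempty (G ≃g pathGraph n) := by
  obtain ⟨x, hx0, hxu, hx⟩ := hG.exists_geodesic c u
  have hcx : ∀ k ≤ G.dist c u, G.dist c (x k) = k := fun k hk => by
    have := hx 0 k (by omega) hk
    rwa [hx0] at this
  have hpos : ∀ v, v ≠ c → 0 < G.dist c v := fun v hv => hG.pos_dist_of_ne hv.symm
  have hcc : G.dist c c = 0 := dist_self
  -- points on a sphere
  have hsphere : ∀ (k : ℕ) (S : Finset V), 0 < k → k ≤ G.dist c u →
      (∀ v ∈ S, G.dist c v = k) → 2 * k - 1 + S.card ≤ #{v | G.dist c v ≤ k} := by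
    intro k S hk hkD hS
    have hdisj : Disjoint (Finset.univ.filter fun v => G.dist c v ≤ k - 1) S := by
      rw [Finset.disjoint_right]
      intro v hv
      have := hS v hv
      simp only [Finset.mem_filter, Finset.mem_univ, true_and]
      omega
    have hsub : (Finset.univ.filter fun v => G.dist c v ≤ k - 1) ∪ S ⊆
        Finset.univ.filter fun v => G.dist c v ≤ k := by
      intro z
      simp only [Finset.mem_union, Finset.mem_filter, Finset.mem_univ, true_and]
      rintro (h | h)
      · omega
      · exact (hS z h).le
    have := Finset.card_le_card hsub
    rw [Finset.card_union_of_disjoint hdisj, hball _ (by omega)] at this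
    omega
  have hballn : ∀ k, #{v | G.dist c v ≤ k} ≤ n := fun k => hn ▸ Finset.card_le_univ _
  have hDn : 2 * G.dist c u ≤ n := by
    have := hsphere (G.dist c u) {u} (by omega) le_rfl (by simp)
    have := hballn (G.dist c u)
    simp only [Finset.card_singleton] at *
    omega
  -- `X` is the geodesic from `c` to `u`, `Y` the remaining points
  let X : V → Prop := fun v => v ≠ c ∧ x (G.dist c v) = v
  let Y : V → Prop := fun v => v ≠ c ∧ x (G.dist c v) ≠ v
  have hXX : ∀ v w, X v → X w → G.dist c v ≤ G.dist c w →
      G.dist v w = G.dist c w - G.dist c v := by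
    intro v w hv hw h
    have := hx _ _ h (hD w)
    rwa [hv.2, hw.2] at this
  have hXX' : ∀ v w, X v → X w → G.dist v w < G.dist c v + G.dist c w := by
    intro v w hv hw
    have := hpos v hv.1
    have := hpos w hw.1
    rcases le_total (G.dist c v) (G.dist c w) with h | h
    · have := hXX v w hv hw h; omega
    · have := hXX w v hw hv h
      rw [G.dist_comm] at this
      omega
  have hXinj : ∀ v w, X v → X w → G.dist c v = G.dist c w → v = w := by
    intro v w hv hw h
    rw [← hv.2, ← hw.2, h]
  have hYcard : ∀ y, Y y → 2 * G.dist c y + 1 ≤ #{v | G.dist c v ≤ G.dist c y} := by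
    intro y hy
    have h0 := hpos y hy.1
    have := hsphere (G.dist c y) {x (G.dist c y), y} h0 (hD y) (by
      intro v hv
      simp only [Finset.mem_insert, Finset.mem_singleton] at hv
      rcases hv with rfl | rfl
      · exact hcx _ (hD y)
      · rfl)
    rw [Finset.card_pair hy.2] at this
    omega
  have hYinj : ∀ v w, Y v → Y w → G.dist c v = G.dist c w → v = w := by
    intro v w hv hw h
    by_contra hne
    have h0 := hpos v hv.1
    have h1 := hsphere (G.dist c v) {x (G.dist c v), v, w} h0 (hD v) (by
      intro z hz
      simp only [Finset.mem_insert, Finset.mem_singleton] at hz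
      rcases hz with rfl | rfl | rfl
      · exact hcx _ (hD v)
      · rfl
      · exact h.symm)
    rw [Finset.card_eq_three.mpr ⟨_, _, _, hv.2, by rw [h]; exact hw.2, hne, rfl⟩] at h1
    rcases (hD v).lt_or_eq with h2 | h2
    · have := hball _ h2
      omega
    · have := hballn (G.dist c v)
      omega
  have hσ' : ∀ v, G.dist v (σ.symm v) = G.dist c v + G.dist c (σ.symm v) := by
    intro v
    have := hσ (σ.symm v)
    rw [σ.apply_symm_apply, G.dist_comm] at this
    omega
  have hYX : ∀ y, Y y → ∃ w, X w ∧ G.dist y w = G.dist c y + G.dist c w := by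
    intro y hy
    have hle : G.dist c u ≤ (Finset.univ.filter X).card := by
      have hsub : (Finset.Icc 1 (G.dist c u)).image x ⊆ Finset.univ.filter X := by
        intro v hv
        obtain ⟨k, hk, rfl⟩ := Finset.mem_image.mp hv
        rw [Finset.mem_Icc] at hk
        have := hcx k hk.2
        simp only [Finset.mem_filter, Finset.mem_univ, true_and, X, this, and_true]
        intro hc
        rw [hc] at this
        omega
      have hinj : Set.InjOn x (Finset.Icc 1 (G.dist c u)) := by
        intro k hk l hl h
        simp only [Finset.coe_Icc, Set.mem_Icc] at hk hl
        rw [← hcx k hk.2, ← hcx l hl.2, h]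
      have := Finset.card_le_card hsub
      rwa [Finset.card_image_of_injOn hinj, Nat.card_Icc, Nat.add_sub_cancel] at this
    have := exists_neighbor_mem (X := Finset.univ.filter X) hσ₁ (fun v hv hv' => by
      simp only [Finset.mem_filter, Finset.mem_univ, true_and] at hv hv'
      exact absurd (hσ v) (hXX' _ _ hv hv').ne) (by omega) (y := y) (by
      simp only [Finset.mem_filter, Finset.mem_univ, true_and]
      exact fun h => hy.2 h.2)
    simp only [Finset.mem_filter, Finset.mem_univ, true_and] at this
    rcases this with h | h
    · exact ⟨_, h, hσ y⟩
    · exact ⟨_, h, hσ' y⟩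
  have hno₁ : ∀ y w, Y y → X w → G.dist c w ≤ G.dist c y → ¬ G.Adj y w := by
    intro y w hy hw hle hadj
    obtain ⟨z, hz, hyz⟩ := hYX y hy
    have h1 := hG.dist_triangle (u := y) (v := w) (w := z)
    have h2 := dist_eq_one_iff_adj.mpr hadj
    have := hpos w hw.1
    have := hpos z hz.1
    rcases le_total (G.dist c w) (G.dist c z) with h | h
    · have := hXX w z hw hz h; omega
    · have := hXX z w hz hw h
      rw [G.dist_comm] at this
      omega
  have hYY : ∀ k y z, Y y → Y z → G.dist c y + k = G.dist c z → G.dist y z ≤ k := by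
    intro k
    induction k with
    | zero =>
      intro y z hy hz h
      rw [hYinj y z hy hz h, dist_self]
    | succ k ih =>
      intro y z hy hz h
      have h0 := hpos y hy.1
      obtain ⟨w, hw, hd⟩ := hG.exists_parent (c := c) (v := z) (by omega)
      have hwc : w ≠ c := by
        rintro rfl
        omega
      have hwY : Y w := ⟨hwc, fun h => hno₁ z w hz ⟨hwc, h⟩ (by omega) hw.symm⟩
      have h1 := ih y w hy hwY (by omega)
      have h2 := dist_eq_one_iff_adj.mpr hw
      have := hG.dist_triangle (u := y) (v := w) (w := z)
      omega
  have hXY : ∀ w, X w → ∃ y, Y y ∧ G.dist w y = G.dist c w + G.dist c y := by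
    intro w hw
    have h1 : ¬ X (σ w) := fun h => absurd (hσ w) (hXX' _ _ hw h).ne
    have h2 : ¬ X (σ.symm w) := fun h => absurd (hσ' w) (hXX' _ _ hw h).ne
    by_cases hc : σ w = c
    · have hc' : σ.symm w ≠ c := by
        intro h
        apply hσ₂ (σ.symm w)
        rw [σ.apply_symm_apply, hc, h]
      exact ⟨_, ⟨hc', fun h => h2 ⟨hc', h⟩⟩, hσ' w⟩
    · exact ⟨_, ⟨hc, fun h => h1 ⟨hc, h⟩⟩, hσ w⟩
  have hno₂ : ∀ y w, Y y → X w → G.dist c y ≤ G.dist c w → ¬ G.Adj w y := by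
    intro y w hy hw hle hadj
    obtain ⟨z, hz, hwz⟩ := hXY w hw
    have h1 := hG.dist_triangle (u := w) (v := y) (w := z)
    have h2 := dist_eq_one_iff_adj.mpr hadj
    have := hpos y hy.1
    have := hpos z hz.1
    rcases le_total (G.dist c y) (G.dist c z) with h | h
    · have := hYY (G.dist c z - G.dist c y) y z hy hz (by omega); omega
    · have := hYY (G.dist c y - G.dist c z) z y hz hy (by omega)
      rw [G.dist_comm] at this
      omega
  have hno : ∀ y w, Y y → X w → ¬ G.Adj w y := by
    intro y w hy hw h
    rcases le_total (G.dist c y) (G.dist c w) with h' | h'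
    · exact hno₂ y w hy hw h' h
    · exact hno₁ y w hy hw h' h.symm
  have hcases : ∀ v, v = c ∨ X v ∨ Y v := fun v => by
    by_cases h : v = c
    · exact Or.inl h
    · by_cases h' : x (G.dist c v) = v
      · exact Or.inr (Or.inl ⟨h, h'⟩)
      · exact Or.inr (Or.inr ⟨h, h'⟩)
  let φ : V → ℤ := fun v => if X v then -(G.dist c v : ℤ) else G.dist c v
  have hφX : ∀ v, X v → φ v = -(G.dist c v : ℤ) := fun v hv => if_pos hv
  have hφY : ∀ v, Y v → φ v = G.dist c v := fun v hv => if_neg fun h => hv.2 h.2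
  have hφc : φ c = 0 := by
    have : ¬ X c := fun h => h.1 rfl
    simp [φ, this]
  have hdiff : ∀ v w, G.Adj v w →
      G.dist c v ≤ G.dist c w + 1 ∧ G.dist c w ≤ G.dist c v + 1 := by
    intro v w h
    have h1 := dist_eq_one_iff_adj.mpr h
    have h2 := dist_eq_one_iff_adj.mpr h.symm
    have := hG.dist_triangle (u := c) (v := v) (w := w)
    have := hG.dist_triangle (u := c) (v := w) (w := v)
    omega
  refine nonempty_iso_pathGraph_of_label hG (c := c) (m := G.dist c u) hn φ ?_ ?_ ?_ ?_ ?_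
  · intro v w h
    rcases hcases v with rfl | hv | hv <;> rcases hcases w with rfl | hw | hw
    · rfl
    · have := hpos w hw.1; have := hφX w hw; omega
    · have := hpos w hw.1; have := hφY w hw; omega
    · have := hpos v hv.1; have := hφX v hv; omega
    · exact hXinj v w hv hw (by have := hφX w hw; have := hφX v hv; omega)
    · have := hpos v hv.1; have := hφX v hv; have := hφY w hw; omega
    · have := hpos v hv.1; have := hφY v hv; omega
    · have := hpos v hv.1; have := hφY v hv; have := hφX w hw; omega
    · exact hYinj v w hv hw (by have := hφY w hw; have := hφY v hv; omega)
  · intro v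
    simp only [φ]
    split_ifs <;> simp
  · intro v w h
    have hd := hdiff v w h
    rcases hcases v with rfl | hv | hv <;> rcases hcases w with rfl | hw | hw
    · exact absurd rfl h.ne
    · have := hpos w hw.1; have := hφX w hw; omega
    · have := hpos w hw.1; have := hφY w hw; omega
    · have := hpos v hv.1; have := hφX v hv; omega
    · have : G.dist c v ≠ G.dist c w := fun e => h.ne (hXinj v w hv hw e)
      have := hφX w hw; have := hφX v hv; omega
    · exact absurd h (hno w v hw hv)
    · have := hpos v hv.1; have := hφY v hv; omega
    · exact absurd h.symm (hno v w hv hw)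
    · have : G.dist c v ≠ G.dist c w := fun e => h.ne (hYinj v w hv hw e)
      have := hφY w hw; have := hφY v hv; omega
  · intro v
    have := hD v
    simp only [φ]
    split_ifs <;> omega
  · intro v
    rcases hcases v with rfl | hv | hv
    · omega
    · have := hφX v hv; have := hpos v hv.1; omega
    · have := hφY v hv
      have h1 := hYcard v hv
      have h2 := hballn (G.dist c v)
      rcases (hD v).lt_or_eq with h | h <;> omega

/-- The sum of the displacements of a permutation, and the case of equality. -/
lemma Connected.sum_dist_perm_le_sq_div_two (hG : G.Connected) {n : ℕ}
    (hn : Fintype.card V = n) (h3 : 3 ≤ n) (σ : Equiv.Perm V) :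
    ∑ v, G.dist v (σ v) ≤ n ^ 2 / 2 ∧
      ((∀ v, σ v ≠ v) → (∀ v, σ (σ v) ≠ v) → ∑ v, G.dist v (σ v) = n ^ 2 / 2 →
        Nonempty (G ≃g pathGraph n)) := by
  classical
  obtain ⟨c, u, hD, hc⟩ := hG.exists_center
  have hge : ∀ t ∈ Finset.range (G.dist c u), 2 * t + 1 ≤ #{v | G.dist c v ≤ t} :=
    fun t ht => card_ball_ge hc t (Finset.mem_range.mp ht)
  have hsum := sum_dist_add_sum_card_ball hD
  have hle := Finset.sum_le_sum hge
  have hσ := hG.sum_dist_perm_le c σ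
  rw [hn] at hsum
  rw [sum_range_two_mul_add_one] at hle
  set D := G.dist c u
  set B := ∑ t ∈ Finset.range D, #{v | G.dist c v ≤ t}
  set W := ∑ v, G.dist c v
  have hsq : 4 * (D * n) ≤ n ^ 2 + 4 * (D * D) := by
    zify
    nlinarith [sq_nonneg ((n : ℤ) - 2 * D)]
  have hsq' : n ^ 2 - 1 ≤ 2 * (n ^ 2 / 2) := by omega
  refine ⟨by omega, fun h1 h2 heq => ?_⟩
  have hWeq : 2 * W = n ^ 2 / 2 := by omega
  have hBeq : D * D = B := by omega
  have hDn : n ≤ 2 * D + 1 := by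
    have : n ^ 2 + 4 * (D * D) ≤ 4 * (D * n) + 1 := by omega
    by_contra! hlt
    zify at this hlt
    nlinarith
  refine hG.nonempty_iso_pathGraph_of_tight hn h3 hD ?_ hDn σ h1 h2 ?_
  · intro t ht
    rw [← sum_range_two_mul_add_one] at hBeq
    exact ((Finset.sum_eq_sum_iff_of_le hge).mp hBeq t (Finset.mem_range.mpr ht)).symm
  · have hpt : ∀ v ∈ Finset.univ, G.dist v (σ v) ≤ G.dist c v + G.dist c (σ v) := fun v _ => by
      rw [G.dist_comm (u := c) (v := v)]; exact hG.dist_triangle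
    have htot : ∑ v, (G.dist c v + G.dist c (σ v)) = 2 * W := by
      rw [Finset.sum_add_distrib, Equiv.sum_comp σ (G.dist c), two_mul]
    intro v
    exact (Finset.sum_eq_sum_iff_of_le hpt).mp (by omega) v (Finset.mem_univ v)

end SimpleGraph

lemma Fin.add_one_mod_injective (n : ℕ) :
    Function.Injective fun i : Fin n => (⟨(i.val + 1) % n, Nat.mod_lt _ i.pos⟩ : Fin n) := by
  intro i j h
  have h : (i.val + 1) % n = (j.val + 1) % n := congrArg Fin.val h
  have := Nat.ModEq.add_right_cancel' 1 h
  exact Fin.ext (Nat.ModEq.eq_of_lt_of_lt this i.isLt j.isLt)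

/-- The cyclic shift of `Fin n`. -/
noncomputable def Fin.cyclicShift (n : ℕ) : Equiv.Perm (Fin n) :=
  Equiv.ofBijective _ (Finite.injective_iff_bijective.mp (Fin.add_one_mod_injective n))

lemma Fin.val_cyclicShift {n : ℕ} (i : Fin n) :
    (Fin.cyclicShift n i).val = if i.val + 1 = n then 0 else i.val + 1 := by
  change (i.val + 1) % n = _
  split_ifs with h
  · rw [h, Nat.mod_self]
  · exact Nat.mod_eq_of_lt (by omega)

lemma cyclicSum_eq_sum_perm {V : Type} [Fintype V] (G : SimpleGraph V) {n : ℕ} (f : Fin n ≃ V) :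
    cyclicSum G f = ∑ v, G.dist v (f.permCongr (Fin.cyclicShift n) v) := by
  rw [← Equiv.sum_comp f]
  simp only [Equiv.permCongr_apply, Equiv.symm_apply_apply]
  rfl

lemma cyclicSum_le_sq_div_two {V : Type} [Fintype V] {G : SimpleGraph V} (hG : G.Connected)
    {n : ℕ} (h3 : 3 ≤ n) (f : Fin n ≃ V) : cyclicSum G f ≤ n ^ 2 / 2 := by
  rw [cyclicSum_eq_sum_perm]
  exact (hG.sum_dist_perm_le_sq_div_two (by simp [← Fintype.card_congr f]) h3 _).1

lemma nonempty_iso_pathGraph_of_cyclicSum_eq {V : Type} [Fintype V] {G : SimpleGraph V}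
    (hG : G.Connected) {n : ℕ} (h3 : 3 ≤ n) (f : Fin n ≃ V) (h : cyclicSum G f = n ^ 2 / 2) :
    Nonempty (G ≃g pathGraph n) := by
  rw [cyclicSum_eq_sum_perm] at h
  refine (hG.sum_dist_perm_le_sq_div_two (by simp [← Fintype.card_congr f]) h3 _).2 ?_ ?_ h
  · intro v hv
    rw [Equiv.permCongr_apply, ← Equiv.eq_symm_apply] at hv
    have := congrArg Fin.val hv
    rw [Fin.val_cyclicShift] at this
    split_ifs at this <;> omega
  · intro v hv
    rw [Equiv.permCongr_apply, Equiv.permCongr_apply, Equiv.symm_apply_apply,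
      ← Equiv.eq_symm_apply] at hv
    have := congrArg Fin.val hv
    rw [Fin.val_cyclicShift, Fin.val_cyclicShift] at this
    split_ifs at this <;> omega

/-- The ordering `0, h, 1, h + 1, 2, …` of a path with `h = ⌈n / 2⌉`. -/
def zigzag (n : ℕ) (i : Fin n) : Fin n :=
  ⟨if i.val % 2 = 0 then i.val / 2 else (n + 1) / 2 + i.val / 2, by split_ifs <;> omega⟩

lemma zigzag_injective (n : ℕ) : Function.Injective (zigzag n) := by
  intro i j h
  have := congrArg Fin.val h
  simp only [zigzag] at this
  ext
  split_ifs at this <;> omega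

lemma exists_sq_div_two_le_cyclicSum {V : Type} {G : SimpleGraph V} (hG : G.Connected)
    {n : ℕ} (h3 : 3 ≤ n) (e : G ≃g pathGraph n) :
    ∃ f : Fin n ≃ V, n ^ 2 / 2 ≤ cyclicSum G f := by
  let z : Fin n ≃ Fin n :=
    Equiv.ofBijective _ (Finite.injective_iff_bijective.mp (zigzag_injective n))
  refine ⟨z.trans e.toEquiv.symm, ?_⟩
  have hdist : ∀ i j : Fin n,
      (((zigzag n i).val : ℤ) - (zigzag n j).val).natAbs ≤
        G.dist (z.trans e.toEquiv.symm i) (z.trans e.toEquiv.symm j) := by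
    intro i j
    have := hG.natAbs_sub_le_dist (fun v => ((e v).val : ℤ)) (fun u v h => by
      have := pathGraph_adj.mp (e.map_rel_iff.mpr h)
      omega) (z.trans e.toEquiv.symm i) (z.trans e.toEquiv.symm j)
    have he : ∀ i, e (z.trans e.toEquiv.symm i) = zigzag n i := fun i =>
      e.toEquiv.apply_symm_apply _
    simpa only [he] using this
  let t : ℕ → ℕ := fun k => if k + 1 = n then (if n % 2 = 0 then n - 1 else (n - 1) / 2)
    else if k % 2 = 0 then (n + 1) / 2 else (n + 1) / 2 - 1
  have hle : ∑ i : Fin n, t i ≤ cyclicSum G (z.trans e.toEquiv.symm) := by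
    refine Finset.sum_le_sum fun i _ => ?_
    have h := hdist i (Fin.cyclicShift n i)
    have hs := Fin.val_cyclicShift i
    change t i ≤ G.dist (z.trans e.toEquiv.symm i) (z.trans e.toEquiv.symm (Fin.cyclicShift n i))
    simp only [zigzag] at h
    have := i.isLt
    simp only [t]
    split_ifs at * <;> omega
  refine le_trans ?_ hle
  rw [Fin.sum_univ_eq_sum_range t n]
  have hpart : ∀ k, k + 1 ≤ n →
      ∑ i ∈ Finset.range k, t i + k / 2 = k * ((n + 1) / 2) := by
    intro k
    induction k with
    | zero => simp
    | succ k ih =>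
      intro hk
      have := ih (by omega)
      rw [Finset.sum_range_succ, add_mul, one_mul]
      have hk' : t k = if k % 2 = 0 then (n + 1) / 2 else (n + 1) / 2 - 1 :=
        if_neg (by omega)
      split_ifs at hk' <;> omega
  obtain ⟨k, rfl⟩ : ∃ k, n = k + 1 := ⟨n - 1, by omega⟩
  have h1 := hpart k le_rfl
  rw [Finset.sum_range_succ]
  have h2 : t k = if (k + 1) % 2 = 0 then k else k / 2 := by simp [t]
  rw [h2]
  rcases Nat.even_or_odd' k with ⟨m, rfl | rfl⟩
  · rw [show (2 * m + 1 + 1) / 2 = m + 1 by omega] at h1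
    rw [if_neg (by omega)]
    have : (2 * m + 1) ^ 2 / 2 = 2 * m * (m + 1) := by
      rw [show (2 * m + 1) ^ 2 = 2 * (2 * m * (m + 1)) + 1 by ring]
      omega
    omega
  · rw [show (2 * m + 1 + 1 + 1) / 2 = m + 1 by omega] at h1
    rw [if_pos (by omega)]
    have : (2 * m + 1 + 1) ^ 2 / 2 = (2 * m + 1) * (m + 1) + (m + 1) := by
      rw [show (2 * m + 1 + 1) ^ 2 = 2 * ((2 * m + 1) * (m + 1) + (m + 1)) by ring]
      omega
    omega

theorem stmt16 {V : Type} [Fintype V] (G : SimpleGraph V) (hG : G.Connected)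
    {n : ℕ} (hn : Fintype.card V = n) (h3 : 3 ≤ n) :
    sSup {m | ∃ f : Fin n ≃ V, cyclicSum G ⇑f = m} ≤ n ^ 2 / 2 ∧
    (sSup {m | ∃ f : Fin n ≃ V, cyclicSum G ⇑f = m} = n ^ 2 / 2 ↔
      Nonempty (G ≃g pathGraph n)) := by
  have hne : {m | ∃ f : Fin n ≃ V, cyclicSum G ⇑f = m}.Nonempty :=
    ⟨_, (Fintype.equivFinOfCardEq hn).symm, rfl⟩
  have hub : ∀ m ∈ {m | ∃ f : Fin n ≃ V, cyclicSum G ⇑f = m}, m ≤ n ^ 2 / 2 := by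
    rintro _ ⟨f, rfl⟩
    exact cyclicSum_le_sq_div_two hG h3 f
  refine ⟨csSup_le hne hub, fun h => ?_, fun ⟨e⟩ => ?_⟩
  · obtain ⟨f, hf⟩ := Nat.sSup_mem hne ⟨_, hub⟩
    exact nonempty_iso_pathGraph_of_cyclicSum_eq hG h3 f (hf.trans h)
  · obtain ⟨f, hf⟩ := exists_sq_div_two_le_cyclicSum hG h3 e
    exact le_antisymm (csSup_le hne hub) (hf.trans (le_csSup ⟨_, hub⟩ ⟨f, rfl⟩))
end
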